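/- Let G=(V,E) be a finite simple undirected graph with preferences as described, assume P≠∅, let x∈P, and let σ be a strongly stable matching in G. Let v ∈ R' and let e={v,w} be an edge in E_x(v). Then w ∈ R'. -/

import Mathlib

/-!
Common setup: a finite simple undirected graph `G = (V, E)` where edges are
elements of `Sym2 V`, together with, for each vertex `v`, a complete and
transitive preference relation `pref v` on `E(v) ∪ {∅}` (the unmatched
option `∅` is encoded as `none : Option (Sym2 V)`), where every incident
edge is strictly preferred to `∅`.
-/

/-- A roommates instance: a finite simple graph with preferences. -/
structure RSetup (V : Type*) [Fintype V] [DecidableEq V] where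
  /-- the edge set -/
  E : Finset (Sym2 V)
  /-- the graph is simple: no loops -/
  not_diag : ∀ e ∈ E, ¬ e.IsDiag
  /-- the preference relation `≿ᵥ` of each vertex, on `E(v) ∪ {∅}` -/
  pref : V → Option (Sym2 V) → Option (Sym2 V) → Prop
  /-- completeness of `≿ᵥ` on `E(v) ∪ {∅}` -/
  pref_total : ∀ v : V, ∀ a b : Option (Sym2 V),
    (∀ e, a = some e → e ∈ E ∧ v ∈ e) → (∀ e, b = some e → e ∈ E ∧ v ∈ e) →
    pref v a b ∨ pref v b a
  /-- transitivity of `≿ᵥ` on `E(v) ∪ {∅}` -/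
  pref_trans : ∀ v : V, ∀ a b c : Option (Sym2 V),
    (∀ e, a = some e → e ∈ E ∧ v ∈ e) → (∀ e, b = some e → e ∈ E ∧ v ∈ e) →
    (∀ e, c = some e → e ∈ E ∧ v ∈ e) →
    pref v a b → pref v b c → pref v a c
  /-- every incident edge is strictly preferred to being unmatched -/
  pref_none : ∀ v : V, ∀ e ∈ E, v ∈ e →
    pref v (some e) none ∧ ¬ pref v none (some e)

namespace RSetup

variable {V : Type*} [Fintype V] [DecidableEq V] (S : RSetup V)

/-- `a ≻ᵥ b` : strict preference. -/
def SPref (v : V) (a b : Option (Sym2 V)) : Prop :=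
  S.pref v a b ∧ ¬ S.pref v b a

/-- `a ∼ᵥ b` : indifference. -/
def IPref (v : V) (a b : Option (Sym2 V)) : Prop :=
  S.pref v a b ∧ S.pref v b a

/-- `F(v)` : the set of edges in `F` incident to `v`. -/
def inc (F : Finset (Sym2 V)) (v : V) : Finset (Sym2 V) :=
  F.filter (fun e => v ∈ e)

/-- a matching in `G` -/
def IsMatching (μ : Finset (Sym2 V)) : Prop :=
  μ ⊆ S.E ∧ ∀ v : V, (inc μ v).card ≤ 1

/-- `μ(v)` : the edge of `μ` incident to `v` (or `none`). -/
noncomputable def matchOf (μ : Finset (Sym2 V)) (v : V) : Option (Sym2 V) :=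
  (inc μ v).toList.head?

/-- `e` blocks the matching `μ`. -/
def Blocks (μ : Finset (Sym2 V)) (e : Sym2 V) : Prop :=
  e ∈ S.E ∧ e ∉ μ ∧ (∀ v ∈ e, S.pref v (some e) (matchOf μ v)) ∧
    (∃ v ∈ e, S.SPref v (some e) (matchOf μ v))

/-- a strongly stable matching in `G` -/
def StronglyStable (μ : Finset (Sym2 V)) : Prop :=
  S.IsMatching μ ∧ ∀ e : Sym2 V, ¬ S.Blocks μ e

/-- `x(W) = ∑_{e ∈ W} x(e)` -/
def xS (x : Sym2 V → ℝ) (W : Finset (Sym2 V)) : ℝ := ∑ e ∈ W, x e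

/-- `x ∈ ℝ₊^E`, encoded as a nonnegative function on `Sym2 V` vanishing
outside `E`. -/
def IsVec (x : Sym2 V → ℝ) : Prop :=
  (∀ e, 0 ≤ x e) ∧ ∀ e ∉ S.E, x e = 0

open Classical in
/-- `E[∼ᵥ e] = {f ∈ E(v) : f ∼ᵥ e}` -/
noncomputable def simSet (v : V) (e : Sym2 V) : Finset (Sym2 V) :=
  (inc S.E v).filter (fun f => S.IPref v (some f) (some e))

open Classical in
/-- `E[≻ᵥ e] = {f ∈ E(v) : f ≻ᵥ e}` -/
noncomputable def succSet (v : V) (e : Sym2 V) : Finset (Sym2 V) :=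
  (inc S.E v).filter (fun f => S.SPref v (some f) (some e))

open Classical in
/-- `E⟨X⟩ = {e ∈ E : e ⊆ X}` -/
noncomputable def esub (X : Finset V) : Finset (Sym2 V) :=
  S.E.filter (fun e => ∀ u ∈ e, u ∈ X)

/-- constraint (1): `x(E(v)) ≤ 1` for every vertex `v` -/
def C1 (x : Sym2 V → ℝ) : Prop := ∀ v : V, xS x (inc S.E v) ≤ 1

/-- constraint (2): `x(E[∼ᵥ e]) + ∑_{w ∈ e} x(E[≻_w e]) ≥ 1`
for every edge `e ∈ E` and `v ∈ e` -/
def C2 (x : Sym2 V → ℝ) : Prop := ∀ v w : V, s(v, w) ∈ S.E →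
  xS x (S.simSet v s(v, w)) +
    (xS x (S.succSet v s(v, w)) + xS x (S.succSet w s(v, w))) ≥ 1

/-- constraint (3): `x(E⟨X⟩) ≤ ⌊|X|/2⌋` for every odd `X ⊆ V` -/
def C3 (x : Sym2 V → ℝ) : Prop := ∀ X : Finset V, Odd X.card →
  xS x (S.esub X) ≤ ((X.card / 2 : ℕ) : ℝ)

/-- membership in the polytope `P` -/
def memP (x : Sym2 V → ℝ) : Prop := S.IsVec x ∧ S.C1 x ∧ S.C2 x ∧ S.C3 x

/-- the characteristic vector `χ_μ` of a set of edges -/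
def chi (μ : Finset (Sym2 V)) : Sym2 V → ℝ := fun e => if e ∈ μ then 1 else 0

open Classical in
/-- `E_x = {e ∈ E : x(e) > 0}` -/
noncomputable def supp (x : Sym2 V → ℝ) : Finset (Sym2 V) :=
  S.E.filter (fun e => 0 < x e)

/-- `V₁` : the set of vertices `v` with `x(E(v)) > 0` for some `x ∈ P` -/
def V1 : Set V := {v : V | ∃ x : Sym2 V → ℝ, S.memP x ∧ 0 < xS x (inc S.E v)}

open Classical in
/-- `B_x(v)` : the best edges in `E_x(v)` for `v` -/
noncomputable def Bset (x : Sym2 V → ℝ) (v : V) : Finset (Sym2 V) :=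
  (inc (S.supp x) v).filter
    (fun e => ∀ f ∈ inc (S.supp x) v, S.pref v (some e) (some f))

open Classical in
/-- `W_x(v)` : the worst edges in `E_x(v)` for `v` -/
noncomputable def Wset (x : Sym2 V → ℝ) (v : V) : Finset (Sym2 V) :=
  (inc (S.supp x) v).filter
    (fun e => ∀ f ∈ inc (S.supp x) v, S.pref v (some f) (some e))

/-- a nonempty `F ⊆ E(v)` is flat if `v` is indifferent among its members -/
def Flat (v : V) (F : Finset (Sym2 V)) : Prop :=
  F.Nonempty ∧ ∀ e ∈ F, ∀ f ∈ F, S.IPref v (some e) (some f)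

open Classical in
/-- `T_x` : edges `e ∈ E⟨V₁⟩` such that, for each `v ∈ e`, either
`e ∈ B_x(v) ∪ W_x(v)` or `B_x(v) ≻ᵥ e ≻ᵥ W_x(v)`. -/
noncomputable def Tset (x : Sym2 V → ℝ) : Finset (Sym2 V) :=
  (S.E.filter (fun e => ∀ u ∈ e, u ∈ S.V1)).filter (fun e => ∀ v ∈ e,
    (e ∈ S.Bset x v ∪ S.Wset x v) ∨
      ((∀ f ∈ S.Bset x v, S.SPref v (some f) (some e)) ∧
        (∀ f ∈ S.Wset x v, S.SPref v (some e) (some f))))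

/-- membership in `P(F) = {x ∈ P : x(e) = 0 for all e ∈ E \ F}` -/
def memPF (F : Finset (Sym2 V)) (x : Sym2 V → ℝ) : Prop :=
  S.memP x ∧ ∀ e ∈ S.E, e ∉ F → x e = 0

open Classical in
/-- `E⁺ = {e ∈ E : e ∈ E_z for some z ∈ P}` -/
noncomputable def Eplus : Finset (Sym2 V) :=
  S.E.filter (fun e => ∃ z : Sym2 V → ℝ, S.memP z ∧ 0 < z e)

open Classical in
/-- `P'` : given `x ∈ P` and a strongly stable matching `σ`, the set of
vertices `v ∈ V₁` with `W_x(v) ≻ᵥ σ(v)`, or with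
`B_x(v) ≻ᵥ W_x(v)` and `W_x(v) ∼ᵥ σ(v)`. -/
def Pset (x : Sym2 V → ℝ) (σ : Finset (Sym2 V)) : Set V :=
  {v : V | v ∈ S.V1 ∧
    ((∀ f ∈ S.Wset x v, S.SPref v (some f) (matchOf σ v)) ∨
      ((∀ f ∈ S.Bset x v, ∀ g ∈ S.Wset x v, S.SPref v (some f) (some g)) ∧
        (∀ f ∈ S.Wset x v, S.IPref v (some f) (matchOf σ v))))}

/-- `Q'` : given `x ∈ P` and a strongly stable matching `σ`, the set of
vertices `v ∈ V₁` with `σ(v) ≻ᵥ B_x(v)`, or with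
`B_x(v) ≻ᵥ W_x(v)` and `B_x(v) ∼ᵥ σ(v)`. -/
def Qset (x : Sym2 V → ℝ) (σ : Finset (Sym2 V)) : Set V :=
  {v : V | v ∈ S.V1 ∧
    ((∀ f ∈ S.Bset x v, S.SPref v (matchOf σ v) (some f)) ∨
      ((∀ f ∈ S.Bset x v, ∀ g ∈ S.Wset x v, S.SPref v (some f) (some g)) ∧
        (∀ f ∈ S.Bset x v, S.IPref v (some f) (matchOf σ v))))}

/-- `R'` : given `x ∈ P` and a strongly stable matching `σ`, the set of
vertices `v ∈ V₁` such that `E_x(v)` is flat and `E_x(v) ∼ᵥ σ(v)`. -/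
def Rset (x : Sym2 V → ℝ) (σ : Finset (Sym2 V)) : Set V :=
  {v : V | v ∈ S.V1 ∧ S.Flat v (inc (S.supp x) v) ∧
    ∀ f ∈ inc (S.supp x) v, S.IPref v (some f) (matchOf σ v)}

end RSetup

namespace RSetup

variable {V : Type*}

theorem le_xS {x : Sym2 V → ℝ} (hx : ∀ e, 0 ≤ x e) {W : Finset (Sym2 V)} {e : Sym2 V}
    (he : e ∈ W) : x e ≤ xS x W :=
  Finset.single_le_sum (f := x) (fun f _ => hx f) he

theorem xS_nonneg {x : Sym2 V → ℝ} (hx : ∀ e, 0 ≤ x e) (W : Finset (Sym2 V)) : 0 ≤ xS x W :=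
  Finset.sum_nonneg fun f _ => hx f

variable [DecidableEq V]

theorem mem_inc {F : Finset (Sym2 V)} {v : V} {e : Sym2 V} : e ∈ inc F v ↔ e ∈ F ∧ v ∈ e := by
  simp [inc]

theorem inc_subset_inc {F G : Finset (Sym2 V)} (h : F ⊆ G) (v : V) : inc F v ⊆ inc G v :=
  Finset.filter_subset_filter _ h

theorem mem_of_matchOf_eq_some {μ : Finset (Sym2 V)} {v : V} {e : Sym2 V}
    (h : matchOf μ v = some e) : e ∈ inc μ v :=
  Finset.mem_toList.1 (List.mem_of_head? h)

/-- In a matching, `μ(v)` is the unique edge of `μ` incident to `v`. -/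
theorem matchOf_eq_some {μ : Finset (Sym2 V)} {v : V} {e : Sym2 V} (hμ : (inc μ v).card ≤ 1)
    (he : e ∈ inc μ v) : matchOf μ v = some e := by
  cases h : matchOf μ v with
  | none =>
    have : inc μ v = ∅ := by simpa [matchOf, List.head?_eq_none_iff] using h
    simp [this] at he
  | some f => rw [Finset.card_le_one.1 hμ f (mem_of_matchOf_eq_some h) e he]

theorem chi_nonneg (μ : Finset (Sym2 V)) (e : Sym2 V) : 0 ≤ chi μ e := by
  unfold chi; split_ifs <;> norm_num

theorem one_le_xS_chi {μ W : Finset (Sym2 V)} {e : Sym2 V} (heμ : e ∈ μ) (heW : e ∈ W) :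
    1 ≤ xS (chi μ) W := by
  simpa [chi, heμ] using le_xS (chi_nonneg μ) heW

theorem exists_mem_of_xS_chi_pos {μ W : Finset (Sym2 V)} (h : 0 < xS (chi μ) W) :
    ∃ e ∈ W, e ∈ μ := by
  by_contra! hn
  have : xS (chi μ) W = 0 := Finset.sum_eq_zero fun e he => by simp [chi, hn e he]
  exact h.ne' this

variable [Fintype V] (S : RSetup V)

theorem pref_total_of_mem {v : V} {e f : Sym2 V} (he : e ∈ inc S.E v) (hf : f ∈ inc S.E v) :
    S.pref v (some e) (some f) ∨ S.pref v (some f) (some e) := by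
  rw [mem_inc] at he hf
  apply S.pref_total
  · rintro _ ⟨⟩; exact he
  · rintro _ ⟨⟩; exact hf

theorem pref_trans_of_mem {v : V} {e f g : Sym2 V} (he : e ∈ inc S.E v) (hf : f ∈ inc S.E v)
    (hg : g ∈ inc S.E v) (h₁ : S.pref v (some e) (some f)) (h₂ : S.pref v (some f) (some g)) :
    S.pref v (some e) (some g) := by
  rw [mem_inc] at he hf hg
  refine S.pref_trans v _ (some f) _ ?_ ?_ ?_ h₁ h₂
  · rintro _ ⟨⟩; exact he
  · rintro _ ⟨⟩; exact hf
  · rintro _ ⟨⟩; exact hg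

variable {S}

theorem mem_simSet {v : V} {e f : Sym2 V} :
    f ∈ S.simSet v e ↔ f ∈ inc S.E v ∧ S.IPref v (some f) (some e) := by
  simp [simSet]

theorem mem_succSet {v : V} {e f : Sym2 V} :
    f ∈ S.succSet v e ↔ f ∈ inc S.E v ∧ S.SPref v (some f) (some e) := by
  simp [succSet]

theorem IPref.symm {v : V} {a b : Option (Sym2 V)} (h : S.IPref v a b) : S.IPref v b a :=
  ⟨h.2, h.1⟩

theorem IPref.trans_of_mem {v : V} {e f g : Sym2 V} (he : e ∈ inc S.E v) (hf : f ∈ inc S.E v)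
    (hg : g ∈ inc S.E v) (h₁ : S.IPref v (some e) (some f)) (h₂ : S.IPref v (some f) (some g)) :
    S.IPref v (some e) (some g) :=
  ⟨S.pref_trans_of_mem he hf hg h₁.1 h₂.1, S.pref_trans_of_mem hg hf he h₂.2 h₁.2⟩

theorem supp_subset (x : Sym2 V → ℝ) : S.supp x ⊆ S.E :=
  Finset.filter_subset _ _

theorem StronglyStable.C1_chi {μ : Finset (Sym2 V)} (hμ : S.StronglyStable μ) :
    S.C1 (chi μ) := by
  intro v
  have hle : ((inc S.E v).filter (· ∈ μ)).card ≤ (inc μ v).card :=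
    Finset.card_le_card fun e he => by
      simp only [Finset.mem_filter, mem_inc] at he ⊢
      exact ⟨he.2, he.1.2⟩
  have : xS (chi μ) (inc S.E v) = (((inc S.E v).filter (· ∈ μ)).card : ℝ) := by
    simp [xS, chi, Finset.filter_mem_eq_inter]
  rw [this]
  exact_mod_cast hle.trans (hμ.1.2 v)

theorem mem_simSet_of_IPref_matchOf {μ : Finset (Sym2 V)} (hμ : μ ⊆ S.E) {v : V} {e : Sym2 V}
    (he : e ∈ S.E) (hv : v ∈ e) (h : S.IPref v (some e) (matchOf μ v)) :
    ∃ f ∈ S.simSet v e, f ∈ μ := by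
  cases hm : matchOf μ v with
  | none =>
    rw [hm] at h
    exact absurd h.2 (S.pref_none v e he hv).2
  | some f =>
    have hf := mem_of_matchOf_eq_some hm
    rw [hm] at h
    exact ⟨f, mem_simSet.2 ⟨inc_subset_inc hμ v hf, h.symm⟩, (mem_inc.1 hf).1⟩

theorem mem_succSet_of_not_pref_matchOf {μ : Finset (Sym2 V)} (hμ : μ ⊆ S.E) {v : V}
    {e : Sym2 V} (he : e ∈ S.E) (hv : v ∈ e) (h : ¬ S.pref v (some e) (matchOf μ v)) :
    ∃ f ∈ S.succSet v e, f ∈ μ := by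
  cases hm : matchOf μ v with
  | none =>
    rw [hm] at h
    exact absurd (S.pref_none v e he hv).1 h
  | some f =>
    have hf := mem_of_matchOf_eq_some hm
    have hfE := inc_subset_inc hμ v hf
    rw [hm] at h
    exact ⟨f, mem_succSet.2 ⟨hfE,
      (S.pref_total_of_mem hfE (mem_inc.2 ⟨he, hv⟩)).resolve_right h, h⟩, (mem_inc.1 hf).1⟩

theorem StronglyStable.C2_chi {μ : Finset (Sym2 V)} (hμ : S.StronglyStable μ) :
    S.C2 (chi μ) := by
  intro v w he
  have h₁ := xS_nonneg (chi_nonneg μ) (S.simSet v s(v, w))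
  have h₂ := xS_nonneg (chi_nonneg μ) (S.succSet v s(v, w))
  have h₃ := xS_nonneg (chi_nonneg μ) (S.succSet w s(v, w))
  have hv : v ∈ s(v, w) := Sym2.mem_mk_left v w
  have sim_case : (∃ f ∈ S.simSet v s(v, w), f ∈ μ) → xS (chi μ) (S.simSet v s(v, w)) +
      (xS (chi μ) (S.succSet v s(v, w)) + xS (chi μ) (S.succSet w s(v, w))) ≥ 1 := by
    rintro ⟨f, hf, hfμ⟩
    linarith [one_le_xS_chi hfμ hf]
  by_cases heμ : s(v, w) ∈ μ
  · have hmem := mem_inc.2 ⟨he, hv⟩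
    have hrefl := (S.pref_total_of_mem hmem hmem).elim id id
    exact sim_case ⟨_, mem_simSet.2 ⟨hmem, hrefl, hrefl⟩, heμ⟩
  · by_cases hall : ∀ u ∈ s(v, w), S.pref u (some s(v, w)) (matchOf μ u)
    · refine sim_case (mem_simSet_of_IPref_matchOf hμ.1.1 he hv ⟨hall v hv, ?_⟩)
      by_contra hn
      exact hμ.2 _ ⟨he, heμ, hall, v, hv, hall v hv, hn⟩
    · push Not at hall
      obtain ⟨u, hu, hpref⟩ := hall
      obtain ⟨f, hf, hfμ⟩ := mem_succSet_of_not_pref_matchOf hμ.1.1 he hu hpref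
      have := one_le_xS_chi hfμ hf
      rcases Sym2.mem_iff.1 hu with rfl | rfl <;> linarith

/-- The `x`-mass that `v` weakly prefers to `e`, with strictly preferred edges counted twice. -/
noncomputable def dominance (S : RSetup V) (x : Sym2 V → ℝ) (v : V) (e : Sym2 V) : ℝ :=
  xS x (S.simSet v e) + 2 * xS x (S.succSet v e)

theorem sum_mul_dominance_add (x y : Sym2 V → ℝ) (v : V) :
    ∑ e ∈ inc S.E v, y e * S.dominance x v e + ∑ e ∈ inc S.E v, x e * S.dominance y v e =
      2 * xS x (inc S.E v) * xS y (inc S.E v) := by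
  classical
  let k : Sym2 V → Sym2 V → ℝ := fun f e =>
    (if S.IPref v (some f) (some e) then 1 else 0) +
      2 * (if S.SPref v (some f) (some e) then 1 else 0)
  have hdom : ∀ z : Sym2 V → ℝ, ∀ e,
      S.dominance z v e = ∑ f ∈ inc S.E v, z f * k f e := by
    intro z e
    simp only [dominance, xS, simSet, succSet, Finset.sum_filter, Finset.mul_sum, k,
      ← Finset.sum_add_distrib]
    refine Finset.sum_congr rfl fun f _ => ?_
    split_ifs <;> ring
  have hk : ∀ e ∈ inc S.E v, ∀ f ∈ inc S.E v, k f e + k e f = 2 := by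
    intro e he f hf
    simp only [k, IPref, SPref]
    rcases S.pref_total_of_mem he hf with h | h
    · by_cases h' : S.pref v (some f) (some e) <;> simp [h, h']; norm_num
    · by_cases h' : S.pref v (some e) (some f) <;> simp [h, h']; norm_num
  simp only [hdom, Finset.mul_sum]
  rw [Finset.sum_comm (f := fun e f => x e * (y f * k f e)), ← Finset.sum_add_distrib]
  simp only [xS, Finset.mul_sum, Finset.sum_mul]
  refine Finset.sum_congr rfl fun e he => ?_
  rw [← Finset.sum_add_distrib]
  refine Finset.sum_congr rfl fun f hf => ?_
  linear_combination (y e * x f) * hk e he f hf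

theorem sum_inc_comm (h : V → Sym2 V → ℝ) :
    ∑ v, ∑ e ∈ inc S.E v, h v e = ∑ e ∈ S.E, ∑ v ∈ e.toFinset, h v e :=
  Finset.sum_comm' fun v e => by simp [mem_inc, and_comm]

theorem sum_toFinset {v w : V} (he : s(v, w) ∈ S.E) (h : V → ℝ) :
    ∑ u ∈ s(v, w).toFinset, h u = h v + h w := by
  have hne : v ≠ w := by simpa using S.not_diag _ he
  rw [Sym2.toFinset_mk_eq, Finset.sum_pair hne]

theorem sum_xS_inc (x : Sym2 V → ℝ) : ∑ v, xS x (inc S.E v) = ∑ e ∈ S.E, 2 * x e := by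
  simp only [xS]
  rw [sum_inc_comm]
  refine Finset.sum_congr rfl fun e he => ?_
  induction e with
  | _ v w => rw [sum_toFinset he]; ring

theorem C2.two_le_sum_dominance {x : Sym2 V → ℝ} (hx : S.C2 x) {e : Sym2 V} (he : e ∈ S.E) :
    2 ≤ ∑ v ∈ e.toFinset, S.dominance x v e := by
  induction e with
  | _ v w =>
    have h₁ := hx v w he
    have h₂ := hx w v (Sym2.eq_swap ▸ he)
    rw [Sym2.eq_swap (a := w)] at h₂
    rw [sum_toFinset he]
    simp only [dominance]
    linarith

/-- Complementary slackness between two vectors satisfying the degree and stability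
constraints. -/
theorem slackness {x y : Sym2 V → ℝ} (hx : ∀ e, 0 ≤ x e) (hy : ∀ e, 0 ≤ y e)
    (hx₁ : S.C1 x) (hy₁ : S.C1 y) (hx₂ : S.C2 x) (hy₂ : S.C2 y) :
    (∀ v, xS x (inc S.E v) + xS y (inc S.E v) = 2 * xS x (inc S.E v) * xS y (inc S.E v)) ∧
      ∀ e ∈ S.E, 0 < y e → ∑ v ∈ e.toFinset, S.dominance x v e = 2 := by
  have hdouble : ∀ z t : Sym2 V → ℝ, ∑ v, ∑ e ∈ inc S.E v, t e * S.dominance z v e =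
      ∑ e ∈ S.E, t e * ∑ v ∈ e.toFinset, S.dominance z v e := by
    intro z t
    rw [sum_inc_comm]
    simp only [Finset.mul_sum]
  have hvert : ∀ v ∈ Finset.univ, 0 ≤ xS x (inc S.E v) + xS y (inc S.E v) -
      2 * xS x (inc S.E v) * xS y (inc S.E v) := by
    intro v _
    nlinarith [mul_nonneg (xS_nonneg hx (inc S.E v)) (sub_nonneg.2 (hy₁ v)),
      mul_nonneg (xS_nonneg hy (inc S.E v)) (sub_nonneg.2 (hx₁ v))]
  have hedge : ∀ z t : Sym2 V → ℝ, (∀ e, 0 ≤ t e) → S.C2 z → ∀ e ∈ S.E,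
      0 ≤ t e * (∑ v ∈ e.toFinset, S.dominance z v e) - 2 * t e := by
    intro z t ht hz e he
    nlinarith [mul_nonneg (ht e) (sub_nonneg.2 (hz.two_le_sum_dominance he))]
  have htotal : ∑ v, (xS x (inc S.E v) + xS y (inc S.E v) -
        2 * xS x (inc S.E v) * xS y (inc S.E v)) +
      ∑ e ∈ S.E, (y e * (∑ v ∈ e.toFinset, S.dominance x v e) - 2 * y e) +
      ∑ e ∈ S.E, (x e * (∑ v ∈ e.toFinset, S.dominance y v e) - 2 * x e) = 0 := by
    simp only [← sum_mul_dominance_add, Finset.sum_sub_distrib, Finset.sum_add_distrib,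
      hdouble, sum_xS_inc]
    ring
  have n₁ := Finset.sum_nonneg hvert
  have n₂ := Finset.sum_nonneg (hedge x y hy hx₂)
  have n₃ := Finset.sum_nonneg (hedge y x hx hy₂)
  constructor
  · intro v
    have := (Finset.sum_eq_zero_iff_of_nonneg hvert).1 (by linarith) v (Finset.mem_univ v)
    linarith
  · intro e he hpos
    have := (Finset.sum_eq_zero_iff_of_nonneg (hedge x y hy hx₂)).1 (by linarith) e he
    exact mul_left_cancel₀ hpos.ne' (by linarith)

/-- The endpoints of an edge in the support of `y` have `x`-equally heavy indifference classes. -/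
theorem xS_simSet_eq {x y : Sym2 V → ℝ} (hx : ∀ e, 0 ≤ x e) (hy : ∀ e, 0 ≤ y e)
    (hx₁ : S.C1 x) (hy₁ : S.C1 y) (hx₂ : S.C2 x) (hy₂ : S.C2 y) {v w : V}
    (he : s(v, w) ∈ S.E) (hpos : 0 < y s(v, w)) :
    xS x (S.simSet v s(v, w)) = xS x (S.simSet w s(v, w)) := by
  have h := (slackness hx hy hx₁ hy₁ hx₂ hy₂).2 _ he hpos
  have h₁ := hx₂ v w he
  have h₂ := hx₂ w v (Sym2.eq_swap ▸ he)
  rw [Sym2.eq_swap (a := w)] at h₂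
  rw [sum_toFinset he] at h
  simp only [dominance] at h
  linarith

theorem xS_inc_eq_one {x : Sym2 V → ℝ} (hx : ∀ e, 0 ≤ x e) (hx₁ : S.C1 x) (hx₂ : S.C2 x)
    {v : V} (hpos : 0 < xS x (inc S.E v)) : xS x (inc S.E v) = 1 := by
  have := (slackness hx hx hx₁ hx₁ hx₂ hx₂).1 v
  exact mul_left_cancel₀ hpos.ne' (by linarith)

end RSetup

open RSetup in
/-- Lemma 11: for `x ∈ P`, a strongly stable matching `σ`,
`v ∈ R'`, and an edge `e = {v, w} ∈ E_x(v)`, we have `w ∈ R'`. -/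
theorem mem_Rset_of_adj
    {V : Type*} [Fintype V] [DecidableEq V] (S : RSetup V)
    (hP : ∃ y : Sym2 V → ℝ, S.memP y)
    (x : Sym2 V → ℝ) (hx : S.memP x)
    (σ : Finset (Sym2 V)) (hσ : S.StronglyStable σ)
    (v w : V) (hv : v ∈ S.Rset x σ)
    (he : s(v, w) ∈ inc (S.supp x) v) :
    w ∈ S.Rset x σ := by
  obtain ⟨⟨hx₀, -⟩, hx₁, hx₂, -⟩ := id hx
  obtain ⟨-, ⟨-, hflat⟩, hσv⟩ := hv
  obtain ⟨heS, hve⟩ := mem_inc.1 he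
  have hwe : w ∈ s(v, w) := Sym2.mem_mk_right v w
  have heE := supp_subset x heS
  have hpos : 0 < x s(v, w) := (Finset.mem_filter.1 heS).2
  have hmemv := mem_inc.2 ⟨heE, hve⟩
  have hmemw := mem_inc.2 ⟨heE, hwe⟩
  have hsimv : xS x (S.simSet v s(v, w)) = 1 := by
    rw [← xS_inc_eq_one hx₀ hx₁ hx₂ (hpos.trans_le (le_xS hx₀ hmemv))]
    refine Finset.sum_subset (fun f hf => (mem_simSet.1 hf).1) fun f hf hn => ?_
    by_contra hne
    have hfS : f ∈ inc (S.supp x) v := mem_inc.2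
      ⟨Finset.mem_filter.2 ⟨(mem_inc.1 hf).1, (hx₀ f).lt_of_ne' hne⟩, (mem_inc.1 hf).2⟩
    exact hn (mem_simSet.2 ⟨hf, hflat f hfS _ he⟩)
  have hsimw : xS x (S.simSet w s(v, w)) = 1 :=
    (xS_simSet_eq hx₀ hx₀ hx₁ hx₁ hx₂ hx₂ heE hpos).symm.trans hsimv
  have hsim : ∀ f ∈ inc (S.supp x) w, S.IPref w (some f) (some s(v, w)) := by
    intro f hf
    have hfE := inc_subset_inc (supp_subset x) w hf
    by_contra hn
    have hlt : xS x (S.simSet w s(v, w)) < xS x (inc S.E w) :=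
      Finset.sum_lt_sum_of_subset (fun g hg => (mem_simSet.1 hg).1) hfE
        (fun h => hn (mem_simSet.1 h).2) (Finset.mem_filter.1 (mem_inc.1 hf).1).2
        fun g _ _ => hx₀ g
    linarith [hx₁ w]
  have hσw : S.IPref w (some s(v, w)) (matchOf σ w) := by
    obtain ⟨f, hf, hfσ⟩ := mem_simSet_of_IPref_matchOf hσ.1.1 heE hve (hσv _ he)
    have hone := one_le_xS_chi hfσ hf
    rw [xS_simSet_eq (chi_nonneg σ) hx₀ hσ.C1_chi hx₁ hσ.C2_chi hx₂ heE hpos] at hone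
    obtain ⟨g, hg, hgσ⟩ := exists_mem_of_xS_chi_pos (zero_lt_one.trans_le hone)
    obtain ⟨hgE, hgI⟩ := mem_simSet.1 hg
    rw [matchOf_eq_some (hσ.1.2 w) (mem_inc.2 ⟨hgσ, (mem_inc.1 hgE).2⟩)]
    exact hgI.symm
  have hsub := inc_subset_inc (supp_subset (S := S) x) w
  refine ⟨⟨x, hx, hpos.trans_le (le_xS hx₀ hmemw)⟩,
    ⟨⟨s(v, w), mem_inc.2 ⟨heS, hwe⟩⟩, fun f hf g hg =>
      (hsim f hf).trans_of_mem (hsub hf) hmemw (hsub hg) (hsim g hg).symm⟩, fun f hf => ?_⟩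
  cases hm : matchOf σ w with
  | none =>
    rw [hm] at hσw
    exact absurd hσw.2 (S.pref_none w _ heE hwe).2
  | some g =>
    rw [hm] at hσw
    exact (hsim f hf).trans_of_mem (hsub hf) hmemw
      (inc_subset_inc hσ.1.1 w (mem_of_matchOf_eq_some hm)) hσw
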